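/- Let k ≥ 2 and n ≥ 2k+1 be integers, and let ℱ ⊆ ([n] choose k) be an intersecting family. If ℱ is not a star (i.e., there is no element x ∈ [n] contained in every member of ℱ), then |ℱ| ≤ C(n−1,k−1) − C(n−k−1,k−1) + 1. Moreover, if k = 2 or k ≥ 4, equality holds if and only if ℱ is isomorphic to ℋℳ(n,k); if k = 3, equality holds if and only if ℱ is isomorphic to ℋℳ(n,3) or to 𝒯(n,3). -/

import Mathlib

open Finset

/-- `ℋℳ(n,k) = {F ∈ ([n] choose k) : 1 ∈ F, F ∩ [2,k+1] ≠ ∅} ∪ {[2,k+1]}`. -/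
def HMfam (n k : ℕ) : Finset (Finset ℕ) :=
  insert (Icc 2 (k + 1))
    ((powersetCard k (Icc 1 n)).filter fun A => 1 ∈ A ∧ (A ∩ Icc 2 (k + 1)).Nonempty)

/-- `𝒯(n,3) = {F ∈ ([n] choose 3) : |F ∩ [3]| ≥ 2}`. -/
def Tfam (n : ℕ) : Finset (Finset ℕ) :=
  (powersetCard 3 (Icc 1 n)).filter fun A => 2 ≤ (A ∩ Icc 1 3).card

/-- `𝒜` is isomorphic to `ℬ` (as families of subsets of `[n]`): some permutation
of `[n]` maps `𝒜` onto `ℬ`. -/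
def IsoTo (n : ℕ) (A B : Finset (Finset ℕ)) : Prop :=
  ∃ σ : Equiv.Perm ℕ, (∀ x ∈ Icc 1 n, σ x ∈ Icc 1 n) ∧
    A.image (fun s => s.image fun x => σ x) = B

namespace HiltonMilner

section

/-- Every member of `A` meets every member of `B`. -/
def CrossInt {α : Type*} (A B : Finset (Finset α)) : Prop :=
  ∀ a ∈ A, ∀ b ∈ B, ∃ x ∈ a, x ∈ b

theorem CrossInt.symm {α : Type*} {A B : Finset (Finset α)} (h : CrossInt A B) : CrossInt B A :=
  fun b hb a ha => (h a ha b hb).imp fun _ hx => ⟨hx.2, hx.1⟩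

variable {α : Type*} [DecidableEq α]

/-- The family obtained from `F` by replacing `n` with `i` in its members whenever possible. -/
def shift (i n : α) (F : Finset (Finset α)) : Finset (Finset α) :=
  F.image fun a => if n ∈ a ∧ i ∉ a ∧ insert i (a.erase n) ∉ F then insert i (a.erase n) else a

/-- Replacing `n` by any element of `S` in a member of `F` yields a member of `F`. -/
def Stable (n : α) (S : Finset α) (F : Finset (Finset α)) : Prop :=
  ∀ a ∈ F, n ∈ a → ∀ i ∈ S, i ∉ a → insert i (a.erase n) ∈ F

theorem mem_shift {i n : α} {F : Finset (Finset α)} {b : Finset α} :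
    b ∈ shift i n F ↔ ∃ a ∈ F,
      (n ∈ a ∧ i ∉ a ∧ insert i (a.erase n) ∉ F ∧ insert i (a.erase n) = b) ∨
        (¬ (n ∈ a ∧ i ∉ a ∧ insert i (a.erase n) ∉ F) ∧ a = b) := by
  simp only [shift, mem_image]
  refine exists_congr fun a => and_congr_right fun _ => ?_
  split_ifs with h
  · simp [h]
  · simp [h]
    tauto

theorem card_shift (i n : α) (F : Finset (Finset α)) : (shift i n F).card = F.card := by
  refine card_image_of_injOn fun a ha b hb hab => ?_
  simp only [mem_coe] at ha hb
  split_ifs at hab with h1 h2 h2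
  · have h3 := congrArg (fun s => insert n (s.erase i)) hab
    simpa [erase_insert, h1.1, h1.2.1, h2.1, h2.2.1, insert_erase] using h3
  · exact absurd (hab ▸ hb) h1.2.2
  · exact absurd (hab ▸ ha) h2.2.2
  · exact hab

theorem shift_subset {i n : α} {k : ℕ} {S : Finset α} {F : Finset (Finset α)} (hi : i ∈ S)
    (hF : F ⊆ powersetCard k S) : shift i n F ⊆ powersetCard k S := by
  intro b hb
  obtain ⟨a, ha, ⟨h1, h2, -, rfl⟩ | ⟨-, rfl⟩⟩ := mem_shift.1 hb
  · have h := mem_powersetCard.1 (hF ha)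
    refine mem_powersetCard.2 ⟨insert_subset hi ((erase_subset _ _).trans h.1), ?_⟩
    rw [card_insert_of_notMem (by simp [h2]), card_erase_add_one h1, h.2]
  · exact hF ha

/-- A member of the shifted family was either there before, or comes from replacing `n`. -/
theorem of_mem_shift {i n : α} {F : Finset (Finset α)} {b : Finset α} (hb : b ∈ shift i n F) :
    (b ∈ F ∧ (n ∈ b → i ∉ b → insert i (b.erase n) ∈ F)) ∨
      ∃ a ∈ F, n ∈ a ∧ i ∉ a ∧ b = insert i (a.erase n) := by
  obtain ⟨a, ha, ⟨h1, h2, -, rfl⟩ | ⟨h, rfl⟩⟩ := mem_shift.1 hb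
  · exact Or.inr ⟨a, ha, h1, h2, rfl⟩
  · exact Or.inl ⟨ha, by tauto⟩

theorem mem_shift_or {i n : α} {F : Finset (Finset α)} {a : Finset α} (ha : a ∈ F) :
    a ∈ shift i n F ∨ n ∈ a ∧ i ∉ a ∧ insert i (a.erase n) ∈ shift i n F := by
  by_cases h : n ∈ a ∧ i ∉ a ∧ insert i (a.erase n) ∉ F
  · exact Or.inr ⟨h.1, h.2.1, mem_shift.2 ⟨a, ha, Or.inl ⟨h.1, h.2.1, h.2.2, rfl⟩⟩⟩
  · exact Or.inl (mem_shift.2 ⟨a, ha, Or.inr ⟨h, rfl⟩⟩)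

theorem shift_closed {i n : α} {F : Finset (Finset α)} {b : Finset α} (hb : b ∈ shift i n F)
    (hn : n ∈ b) (hi : i ∉ b) : insert i (b.erase n) ∈ shift i n F := by
  have h := of_mem_shift hb
  have hin : i ≠ n := by rintro rfl; exact hi hn
  obtain ⟨-, h⟩ | ⟨a, -, -, -, rfl⟩ := h
  · exact mem_shift.2 ⟨_, h hn hi, Or.inr ⟨by simp [hin.symm], rfl⟩⟩
  · simp at hi

theorem CrossInt.shift {i n : α} {A B : Finset (Finset α)} (h : CrossInt A B) :
    CrossInt (shift i n A) (shift i n B) := by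
  have key : ∀ {A B : Finset (Finset α)}, CrossInt A B → ∀ a ∈ A, n ∈ a → i ∉ a → ∀ b ∈ B,
      (n ∈ b → i ∉ b → insert i (b.erase n) ∈ B) → ∃ x ∈ insert i (a.erase n), x ∈ b := by
    intro A B h a ha hna hia b hb hb'
    by_cases hib : i ∈ b
    · exact ⟨i, by simp, hib⟩
    by_cases hnb : n ∈ b
    · obtain ⟨x, hx, hx'⟩ := h a ha _ (hb' hnb hib)
      grind
    · obtain ⟨x, hx, hx'⟩ := h a ha b hb
      grind
  intro a ha b hb
  obtain ⟨ha1, ha2⟩ | ⟨a, ha1, ha2, ha3, rfl⟩ := of_mem_shift ha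
  · obtain ⟨hb1, hb2⟩ | ⟨b, hb1, hb2, hb3, rfl⟩ := of_mem_shift hb
    · exact h a ha1 b hb1
    · obtain ⟨x, hx, hx'⟩ := key h.symm b hb1 hb2 hb3 a ha1 ha2
      exact ⟨x, hx', hx⟩
  · obtain ⟨hb1, hb2⟩ | ⟨b, hb1, hb2, hb3, rfl⟩ := of_mem_shift hb
    · exact key h a ha1 ha2 ha3 b hb1 hb2
    · exact ⟨i, by simp, by simp⟩

theorem filter_shift_subset {i n : α} (F : Finset (Finset α)) (hin : i ≠ n) :
    (shift i n F).filter (n ∈ ·) ⊆ F.filter (n ∈ ·) := by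
  intro b hb
  simp only [mem_filter] at hb ⊢
  obtain ⟨h, -⟩ | ⟨a, ha, h1, h2, rfl⟩ := of_mem_shift hb.1
  · exact ⟨h, hb.2⟩
  · simp [hin.symm] at hb

theorem degree_shift_le {i n : α} (F : Finset (Finset α)) (hin : i ≠ n) :
    ((shift i n F).filter (n ∈ ·)).card ≤ (F.filter (n ∈ ·)).card :=
  card_le_card (filter_shift_subset F hin)

theorem degree_shift_lt {i n : α} {F : Finset (Finset α)} {a : Finset α} (ha : a ∈ F)
    (hn : n ∈ a) (hi : i ∉ a) (h : insert i (a.erase n) ∉ F) :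
    ((shift i n F).filter (n ∈ ·)).card < (F.filter (n ∈ ·)).card := by
  have hin : i ≠ n := by rintro rfl; exact hi hn
  refine card_lt_card ⟨filter_shift_subset F hin, fun hs => ?_⟩
  have h1 := hs (mem_filter.2 ⟨ha, hn⟩)
  obtain ⟨-, h2⟩ | ⟨b, hb, h1, h2, rfl⟩ := of_mem_shift (mem_filter.1 h1).1
  · exact h (h2 hn hi)
  · simp at hi

theorem card_add_choose_le_of_meets {G : Finset (Finset α)} {T K : Finset α} {r : ℕ}
    (hG : G ⊆ powersetCard r T) (hK : K ⊆ T) (h : ∀ g ∈ G, ∃ x ∈ g, x ∈ K) :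
    G.card + (T.card - K.card).choose r ≤ T.card.choose r ∧
      (G.card + (T.card - K.card).choose r = T.card.choose r →
        ∀ g ∈ powersetCard r T, (∃ x ∈ g, x ∈ K) → g ∈ G) := by
  have hd : Disjoint G (powersetCard r (T \ K)) := by
    rw [Finset.disjoint_left]
    intro g hg hg'
    obtain ⟨x, hx, hx'⟩ := h g hg
    exact (mem_sdiff.1 ((mem_powersetCard.1 hg').1 hx)).2 hx'
  have hs : G ∪ powersetCard r (T \ K) ⊆ powersetCard r T :=
    union_subset hG (powersetCard_mono sdiff_subset)
  have hc : (G ∪ powersetCard r (T \ K)).card = G.card + (T.card - K.card).choose r := by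
    rw [card_union_of_disjoint hd, card_powersetCard, card_sdiff_of_subset hK]
  refine ⟨?_, fun heq g hg ⟨x, hx, hx'⟩ => ?_⟩
  · rw [← hc, ← card_powersetCard]
    exact card_le_card hs
  · have := eq_of_subset_of_card_le hs (by rw [hc, heq, card_powersetCard])
    rw [← this, mem_union] at hg
    refine hg.resolve_right fun hg => ?_
    exact (mem_sdiff.1 ((mem_powersetCard.1 hg).1 hx)).2 hx'

theorem nonMemberSubfamily_subset {k : ℕ} {n : α} {S : Finset α} {F : Finset (Finset α)}
    (hF : F ⊆ powersetCard k S) : F.nonMemberSubfamily n ⊆ powersetCard k (S.erase n) := by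
  intro a ha
  rw [mem_nonMemberSubfamily] at ha
  have h := mem_powersetCard.1 (hF ha.1)
  exact mem_powersetCard.2 ⟨subset_erase.2 ⟨h.1, ha.2⟩, h.2⟩

theorem memberSubfamily_subset {k : ℕ} {n : α} {S : Finset α} {F : Finset (Finset α)}
    (hF : F ⊆ powersetCard (k + 1) S) : F.memberSubfamily n ⊆ powersetCard k (S.erase n) := by
  intro a ha
  rw [mem_memberSubfamily] at ha
  have h := mem_powersetCard.1 (hF ha.1)
  rw [card_insert_of_notMem ha.2] at h
  exact mem_powersetCard.2
    ⟨subset_erase.2 ⟨(subset_insert _ _).trans h.1, ha.2⟩, by omega⟩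

theorem exists_mem_notMem_pair {S a : Finset α} {x : α} (h : a.card + 1 < S.card) :
    ∃ i ∈ S, i ∉ a ∧ i ≠ x := by
  have : (insert x a).card < S.card := (card_insert_le _ _).trans_lt h
  obtain ⟨i, hi, hi'⟩ := exists_mem_notMem_of_card_lt_card this
  simp only [mem_insert, not_or] at hi'
  exact ⟨i, hi, hi'.2, hi'.1⟩

theorem CrossInt.memberSubfamily {k : ℕ} {n : α} {S : Finset α} {A B : Finset (Finset α)}
    (hA : A ⊆ powersetCard (k + 1) S) (hB : B ⊆ powersetCard (k + 1) S)
    (hS : 2 * k + 1 < S.card) (hst : Stable n S A) (h : CrossInt A B) :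
    CrossInt (A.memberSubfamily n) (B.memberSubfamily n) := by
  intro a ha b hb
  have ha1 := mem_powersetCard.1 (memberSubfamily_subset hA ha)
  have hb1 := mem_powersetCard.1 (memberSubfamily_subset hB hb)
  rw [mem_memberSubfamily] at ha hb
  obtain ⟨i, hi, hi1, hi2⟩ := exists_mem_notMem_pair (S := S) (a := a ∪ b) (x := n)
    (by have := card_union_le a b; omega)
  have h2 := hst _ ha.1 (by simp) i hi (by grind)
  obtain ⟨x, hx, hx'⟩ := h _ h2 _ hb.1
  grind

end

section

variable {α : Type*} [DecidableEq α]

theorem card_add_card_le_of_crossInt {k : ℕ} {S : Finset α} {A B : Finset (Finset α)}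
    (hS : S.card = 2 * k) (hA : A ⊆ powersetCard k S) (hB : B ⊆ powersetCard k S)
    (h : CrossInt A B) : A.card + B.card ≤ (2 * k).choose k := by
  have hinj : Set.InjOn (fun b => S \ b) (B : Set (Finset α)) := by
    intro a ha b hb hab
    have h1 := (mem_powersetCard.1 (hB ha)).1
    have h2 := (mem_powersetCard.1 (hB hb)).1
    have h3 := congrArg (fun s => S \ s) hab
    simpa [Finset.sdiff_sdiff_eq_self h1, Finset.sdiff_sdiff_eq_self h2] using h3
  have hd : Disjoint A (B.image fun b => S \ b) := by
    rw [Finset.disjoint_left]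
    intro a ha ha'
    obtain ⟨b, hb, rfl⟩ := mem_image.1 ha'
    obtain ⟨x, hx, hx'⟩ := h _ ha b hb
    exact (mem_sdiff.1 hx).2 hx'
  rw [← card_image_of_injOn hinj, ← card_union_of_disjoint hd, ← hS, ← card_powersetCard]
  refine card_le_card (union_subset hA fun a ha => ?_)
  obtain ⟨b, hb, rfl⟩ := mem_image.1 ha
  have h1 := mem_powersetCard.1 (hB hb)
  exact mem_powersetCard.2 ⟨sdiff_subset, by rw [card_sdiff_of_subset h1.1]; omega⟩

theorem one_lt_choose {d l : ℕ} (hl : 0 < l) (h : l < d) : 1 < d.choose l := by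
  obtain ⟨l, rfl⟩ := Nat.exists_eq_succ_of_ne_zero hl.ne'
  obtain ⟨d, rfl⟩ := Nat.exists_eq_succ_of_ne_zero (by omega : d ≠ 0)
  have h1 := Nat.choose_pos (n := d) (k := l) (by omega)
  have h2 := Nat.choose_pos (n := d) (k := l + 1) (by omega)
  simp only [Nat.succ_eq_add_one, Nat.choose_succ_succ] at *
  omega

theorem nonMemberSubfamily_nonempty {k : ℕ} {n : α} {S : Finset α} {A : Finset (Finset α)}
    (hA : A ⊆ powersetCard k S) (hk : k < S.card) (hst : Stable n S A) (hne : A.Nonempty) :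
    (A.nonMemberSubfamily n).Nonempty := by
  obtain ⟨a, ha⟩ := hne
  by_cases hna : n ∈ a
  · obtain ⟨i, hi, hia⟩ := exists_mem_notMem_of_card_lt_card
      (by rw [(mem_powersetCard.1 (hA ha)).2]; exact hk : a.card < S.card)
    refine ⟨_, mem_nonMemberSubfamily.2 ⟨hst a ha hna i hi hia, ?_⟩⟩
    have : n ≠ i := by rintro rfl; exact hia hna
    simp [this]
  · exact ⟨a, mem_nonMemberSubfamily.2 ⟨ha, hna⟩⟩

/-- If all `r`-subsets of `T` that meet `K` also meet `L`, and `L` is not larger than `K`,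
then `K = L`. -/
theorem eq_of_forall_meets {T K L : Finset α} {r : ℕ} (hr : 1 ≤ r) (hK : K ⊆ T)
    (hc : L.card = K.card) (hT : L.card + r ≤ T.card)
    (h : ∀ g ∈ powersetCard r T, (∃ x ∈ g, x ∈ K) → ∃ x ∈ g, x ∈ L) : K = L := by
  by_contra hne
  obtain ⟨y, hy, hyL⟩ : ∃ y ∈ K, y ∉ L := by
    by_contra hcon
    push Not at hcon
    exact hne (eq_of_subset_of_card_le hcon hc.le)
  obtain ⟨g, hg1, hg2, hg3⟩ := exists_subsuperset_card_eq (s := {y}) (t := T \ L) (n := r)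
    (by simp [hyL, hK hy]) (by simpa using hr)
    (by have := le_card_sdiff L T; omega)
  obtain ⟨x, hx, hx'⟩ := h g (mem_powersetCard.2 ⟨hg2.trans sdiff_subset, hg3⟩)
    ⟨y, hg1 (by simp), hy⟩
  exact (mem_sdiff.1 (hg2 hx)).2 hx'

theorem link_bound_of_empty {l : ℕ} {n : α} {S : Finset α} {A B : Finset (Finset α)}
    (hn : n ∈ S) (hS : 2 * (l + 2) + 1 ≤ S.card)
    (hA : A ⊆ powersetCard (l + 2) S) (hB : B ⊆ powersetCard (l + 2) S) (hne : A.Nonempty)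
    (h : CrossInt A B) (hA1 : A.memberSubfamily n = ∅) :
    (B.memberSubfamily n).card + (S.card - 1 - (l + 2)).choose (l + 1)
        ≤ (S.card - 1).choose (l + 1) ∧
      ((B.memberSubfamily n).card + (S.card - 1 - (l + 2)).choose (l + 1)
        = (S.card - 1).choose (l + 1) → A.card = 1) := by
  have hnA : ∀ a ∈ A, n ∉ a := by
    intro a ha hna
    have : a.erase n ∈ A.memberSubfamily n := by simp [insert_erase hna, ha]
    simp [hA1] at this
  have hmeet : ∀ a ∈ A, ∀ g ∈ B.memberSubfamily n, ∃ x ∈ g, x ∈ a := by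
    intro a ha g hg
    obtain ⟨x, hx, hx'⟩ := h a ha _ (mem_memberSubfamily.1 hg).1
    have := hnA a ha
    grind
  have hsub : ∀ a ∈ A, a ⊆ S.erase n ∧ a.card = l + 2 := fun a ha =>
    have h := mem_powersetCard.1 (hA ha)
    ⟨subset_erase.2 ⟨h.1, hnA a ha⟩, h.2⟩
  obtain ⟨a, ha⟩ := hne
  have key := card_add_choose_le_of_meets (memberSubfamily_subset hB) (hsub a ha).1 (hmeet a ha)
  rw [(hsub a ha).2, card_erase_of_mem hn] at key
  refine ⟨key.1, fun heq => card_eq_one.2 ⟨a, eq_singleton_iff_unique_mem.2 ⟨ha, fun b hb => ?_⟩⟩⟩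
  refine (eq_of_forall_meets (T := S.erase n) (r := l + 1) (by omega) (hsub a ha).1
    (by rw [(hsub a ha).2, (hsub b hb).2]) (by rw [(hsub b hb).2, card_erase_of_mem hn]; omega)
    fun g hg hga => hmeet b hb g (key.2 heq g hg hga)).symm

theorem forall_mem_of_stable {n x : α} {S : Finset α} {A B : Finset (Finset α)}
    (hS : 5 ≤ S.card) (hB : B ⊆ powersetCard 2 S)
    (h : CrossInt A B) (hst : Stable n S A) (hx : {x} ∈ A.memberSubfamily n) :
    ∀ b ∈ B, x ∈ b := by
  intro b hb
  rw [mem_memberSubfamily] at hx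
  have hb2 := (mem_powersetCard.1 (hB hb)).2
  by_contra hxb
  obtain ⟨i, hi, hi1, hi2⟩ := exists_mem_notMem_pair (S := S) (a := insert x b) (x := n)
    (by have := card_insert_le x b; omega)
  by_cases hnb : n ∈ b
  · obtain ⟨y, hy, hy'⟩ := h _ (hst _ hx.1 (by simp) i hi (by grind)) b hb
    grind
  · obtain ⟨y, hy, hy'⟩ := h _ hx.1 b hb
    grind

theorem cross_stable {l : ℕ} {n : α} {S : Finset α} {A B : Finset (Finset α)}
    (hn : n ∈ S) (hS : 2 * (l + 2) + 1 ≤ S.card)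
    (hA : A ⊆ powersetCard (l + 2) S) (hB : B ⊆ powersetCard (l + 2) S)
    (hAne : A.Nonempty) (hBne : B.Nonempty) (h : CrossInt A B)
    (hstA : Stable n S A) (hstB : Stable n S B)
    (IH : ∀ k (A B : Finset (Finset α)), 2 * k + 1 ≤ S.card → A ⊆ powersetCard k (S.erase n) →
      B ⊆ powersetCard k (S.erase n) → A.Nonempty → B.Nonempty → CrossInt A B →
      A.card + B.card + (S.card - 1 - k).choose k ≤ (S.card - 1).choose k + 1) :
    A.card + B.card + (S.card - (l + 2)).choose (l + 2) ≤ S.card.choose (l + 2) + 1 ∧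
      (A.card + B.card + (S.card - (l + 2)).choose (l + 2) = S.card.choose (l + 2) + 1 →
        A.card = 1 ∨ B.card = 1 ∨ l = 0 ∧ ∃ x, (∀ a ∈ A, x ∈ a) ∧ ∀ b ∈ B, x ∈ b) := by
  have h0 := IH _ _ _ hS (nonMemberSubfamily_subset hA) (nonMemberSubfamily_subset hB)
    (nonMemberSubfamily_nonempty hA (by omega) hstA hAne)
    (nonMemberSubfamily_nonempty hB (by omega) hstB hBne)
    (fun a ha b hb => h a (mem_nonMemberSubfamily.1 ha).1 b (mem_nonMemberSubfamily.1 hb).1)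
  have hcA := card_memberSubfamily_add_card_nonMemberSubfamily n A
  have hcB := card_memberSubfamily_add_card_nonMemberSubfamily n B
  obtain ⟨d, hd⟩ : ∃ d, S.card = l + 2 + d + 1 := ⟨S.card - (l + 2) - 1, by omega⟩
  have e1 : S.card - (l + 2) = d + 1 := by omega
  have e2 : S.card - 1 - (l + 2) = d := by omega
  have e3 : S.card - 1 - (l + 1) = d + 1 := by omega
  have e4 : S.card - 1 = l + 2 + d := by omega
  have c1 : (d + 1).choose (l + 2) = d.choose (l + 1) + d.choose (l + 2) :=
    Nat.choose_succ_succ _ _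
  have c2 : (l + 2 + d + 1).choose (l + 2)
      = (l + 2 + d).choose (l + 1) + (l + 2 + d).choose (l + 2) := Nat.choose_succ_succ _ _
  have c3 : (d + 1).choose (l + 1) = d.choose l + d.choose (l + 1) := Nat.choose_succ_succ _ _
  rcases (A.memberSubfamily n).eq_empty_or_nonempty with hA1 | hA1
  · have h1 := link_bound_of_empty hn hS hA hB hAne h hA1
    rw [hA1, card_empty] at hcA
    rw [e2, e4] at h0 h1
    rw [e1, hd]
    refine ⟨by omega, fun heq => Or.inl (h1.2 (by omega))⟩
  rcases (B.memberSubfamily n).eq_empty_or_nonempty with hB1 | hB1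
  · have h1 := link_bound_of_empty hn hS hB hA hBne h.symm hB1
    rw [hB1, card_empty] at hcB
    rw [e2, e4] at h0 h1
    rw [e1, hd]
    refine ⟨by omega, fun heq => Or.inr (Or.inl (h1.2 (by omega)))⟩
  have hc1 := CrossInt.memberSubfamily hA hB (by omega) hstA h
  have h1 := IH _ _ _ (by omega) (memberSubfamily_subset hA) (memberSubfamily_subset hB)
    hA1 hB1 hc1
  have hpos := Nat.choose_pos (n := d) (k := l) (by omega)
  rw [e2, e4] at h0
  rw [e3, e4] at h1
  rw [e1, hd]
  refine ⟨by omega, fun heq => Or.inr (Or.inr ?_)⟩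
  have hl : l = 0 := by
    by_contra hl
    have := one_lt_choose (d := d) (l := l) (by omega) (by omega)
    omega
  subst hl
  refine ⟨rfl, ?_⟩
  obtain ⟨a, ha⟩ := hA1
  obtain ⟨b, hb⟩ := hB1
  obtain ⟨x, rfl⟩ := card_eq_one.1 (mem_powersetCard.1 (memberSubfamily_subset hA ha)).2
  obtain ⟨y, rfl⟩ := card_eq_one.1 (mem_powersetCard.1 (memberSubfamily_subset hB hb)).2
  obtain ⟨z, hz, hz'⟩ := hc1 _ ha _ hb
  simp only [mem_singleton] at hz hz'
  subst hz hz'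
  exact ⟨z, forall_mem_of_stable (by omega) hA h.symm hstB hb,
    forall_mem_of_stable (by omega) hB h hstA ha⟩

end

section

theorem cross_singletons {α : Type*} {S : Finset α} {A B : Finset (Finset α)}
    (hA : A ⊆ powersetCard 1 S) (hB : B ⊆ powersetCard 1 S) (hAne : A.Nonempty)
    (hBne : B.Nonempty) (h : CrossInt A B) : A.card = 1 := by
  obtain ⟨b, hb⟩ := hBne
  obtain ⟨a, ha⟩ := hAne
  obtain ⟨y, rfl⟩ := card_eq_one.1 (mem_powersetCard.1 (hB hb)).2
  refine card_eq_one.2 ⟨{y}, eq_singleton_iff_nonempty_unique_mem.2 ⟨⟨a, ha⟩, fun c hc => ?_⟩⟩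
  obtain ⟨z, rfl⟩ := card_eq_one.1 (mem_powersetCard.1 (hA hc)).2
  obtain ⟨w, hw, hw'⟩ := h _ hc _ hb
  simp only [mem_singleton] at hw hw'
  rw [← hw, hw']

variable {α : Type*} [DecidableEq α]

theorem star_of_shift_star {i n x : α} {S : Finset α} {A B : Finset (Finset α)}
    (hi : i ∈ S) (hn : n ∈ S) (hin : i ≠ n) (hS : 5 ≤ S.card)
    (hA : A ⊆ powersetCard 2 S) (hB : B ⊆ powersetCard 2 S) (hne : A.Nonempty)
    (h : CrossInt A B) (heq : A.card + B.card + (S.card - 2).choose 2 = S.card.choose 2 + 1)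
    (hxA : ∀ a ∈ shift i n A, x ∈ a) (hxB : ∀ b ∈ shift i n B, x ∈ b) :
    ∃ x, (∀ a ∈ A, x ∈ a) ∧ ∀ b ∈ B, x ∈ b := by
  have hxS : x ∈ S := by
    obtain ⟨a, ha⟩ : (shift i n A).Nonempty := by
      rw [← card_pos, card_shift]; exact hne.card_pos
    exact (mem_powersetCard.1 (shift_subset hi hA ha)).1 (hxA a ha)
  have hfull : ∀ y ∈ S, y ≠ x → ({x, y} ∈ shift i n A ∧ {x, y} ∈ shift i n B) := by
    have hA' := card_add_choose_le_of_meets (shift_subset hi hA) (K := {x}) (by simpa using hxS)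
      (fun a ha => ⟨x, hxA a ha, by simp⟩)
    have hB' := card_add_choose_le_of_meets (shift_subset hi hB) (K := {x}) (by simpa using hxS)
      (fun b hb => ⟨x, hxB b hb, by simp⟩)
    rw [card_shift, card_singleton] at hA' hB'
    obtain ⟨m, hm⟩ : ∃ m, S.card = m + 2 := ⟨S.card - 2, by omega⟩
    have e1 : S.card - 1 = m + 1 := by omega
    have e2 : S.card - 2 = m := by omega
    rw [e1, hm] at hA' hB'
    rw [e2, hm] at heq
    have c1 : (m + 1).choose 2 = m.choose 1 + m.choose 2 := Nat.choose_succ_succ _ _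
    have c2 : (m + 2).choose 2 = (m + 1).choose 1 + (m + 1).choose 2 := Nat.choose_succ_succ _ _
    rw [Nat.choose_one_right] at c1 c2
    intro y hy hyx
    have hp : ({x, y} : Finset α) ∈ powersetCard 2 S :=
      mem_powersetCard.2 ⟨by grind, card_pair hyx.symm⟩
    exact ⟨hA'.2 (by omega) _ hp ⟨x, by simp, by simp⟩,
      hB'.2 (by omega) _ hp ⟨x, by simp, by simp⟩⟩
  have hxn : x ≠ n := by
    rintro rfl
    obtain ⟨z, hz, hz1, hz2⟩ := exists_mem_notMem_pair (S := S) (a := {i}) (x := x)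
      (by simp; omega)
    rw [mem_singleton] at hz1
    have h1 := shift_closed (hfull z hz hz2).1 (by simp) (by grind)
    have := hxA _ h1
    simp [hin.symm] at this
  by_cases hxi : x ≠ i
  · have key : ∀ F : Finset (Finset α), (∀ a ∈ shift i n F, x ∈ a) → ∀ a ∈ F, x ∈ a := by
      intro F hF a ha
      rcases mem_shift_or ha with h1 | ⟨-, -, h1⟩
      · exact hF a h1
      · have := hF _ h1
        grind
    exact ⟨x, key A hxA, key B hxB⟩
  push Not at hxi
  subst hxi
  have hor : ∀ y ∈ S, y ≠ x → y ≠ n → ({x, y} ∈ A ∨ {n, y} ∈ A) ∧ ({x, y} ∈ B ∨ {n, y} ∈ B) := by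
    have key : ∀ F : Finset (Finset α), ∀ y, y ≠ x → y ≠ n → {x, y} ∈ shift x n F →
        {x, y} ∈ F ∨ {n, y} ∈ F := by
      intro F y hyx hyn hF
      obtain ⟨h, -⟩ | ⟨a, ha, h1, h2, h3⟩ := of_mem_shift hF
      · exact Or.inl h
      · have : a = {n, y} := by
          ext w
          have := congrArg (w ∈ ·) h3
          grind
        exact Or.inr (this ▸ ha)
    exact fun y hy hyx hyn => ⟨key A y hyx hyn (hfull y hy hyx).1, key B y hyx hyn (hfull y hy hyx).2⟩
  have hdis : ∀ u v y z : α, u ≠ v → y ≠ z → y ≠ v → z ≠ u →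
      {u, y} ∈ A → {v, z} ∈ B → False := by
    intro u v y z huv hyz hyv hzu hu hv
    obtain ⟨w, hw, hw'⟩ := h _ hu _ hv
    grind
  have hcov : ∀ F : Finset (Finset α), F ⊆ powersetCard 2 S → (∀ a ∈ shift x n F, x ∈ a) →
      ∀ a ∈ F, a = {x, n} ∨ ∃ y ∈ S, y ≠ x ∧ y ≠ n ∧ (a = {x, y} ∨ a = {n, y}) := by
    intro F hF hs a ha
    obtain ⟨haS, hac⟩ := mem_powersetCard.1 (hF ha)
    obtain ⟨p, q, hpq, rfl⟩ := card_eq_two.1 hac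
    rcases mem_shift_or ha with h1 | ⟨h1, -, -⟩
    · have := hs _ h1
      have := @haS p; have := @haS q
      grind
    · have := @haS p; have := @haS q
      grind
  have key : ∀ u v : α, u ≠ v →
      (∀ y ∈ S, y ≠ u → y ≠ v → ({u, y} ∈ A ∨ {v, y} ∈ A) ∧ ({u, y} ∈ B ∨ {v, y} ∈ B)) →
      (∀ a ∈ A, a = {u, v} ∨ ∃ y ∈ S, y ≠ u ∧ y ≠ v ∧ (a = {u, y} ∨ a = {v, y})) →
      (∀ a ∈ B, a = {u, v} ∨ ∃ y ∈ S, y ≠ u ∧ y ≠ v ∧ (a = {u, y} ∨ a = {v, y})) →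
      (∃ y ∈ S, y ≠ u ∧ y ≠ v ∧ {u, y} ∈ A) → (∀ a ∈ A, u ∈ a) ∧ ∀ b ∈ B, u ∈ b := by
    rintro u v huv hor hcA hcB ⟨y, hy, hyu, hyv, hyA⟩
    have hother : ∀ w : α, ∃ z ∈ S, z ≠ u ∧ z ≠ v ∧ z ≠ y ∧ z ≠ w := by
      intro w
      obtain ⟨z, hz, hz1, hz2⟩ := exists_mem_notMem_pair (S := S) (a := {u, v, y}) (x := w)
        (by have := card_le_three (a := u) (b := v) (c := y); omega)
      exact ⟨z, hz, by grind, by grind, by grind, hz2⟩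
    have hB1 : ∀ z ∈ S, z ≠ u → z ≠ v → z ≠ y → {u, z} ∈ B := fun z hz hzu hzv hzy =>
      (hor z hz hzu hzv).2.resolve_right fun hc =>
        hdis u v y z huv hzy.symm hyv hzu hyA hc
    have hA0 : ∀ w ∈ S, w ≠ u → w ≠ v → {v, w} ∉ A := by
      intro w hw hwu hwv hc
      obtain ⟨z, hz, hzu, hzv, hzy, hzw⟩ := hother w
      exact hdis v u w z huv.symm hzw.symm hwu hzv hc (hB1 z hz hzu hzv hzy)
    have hB0 : ∀ w ∈ S, w ≠ u → w ≠ v → {v, w} ∉ B := by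
      intro w hw hwu hwv hc
      obtain ⟨z, hz, hzu, hzv, hzy, hzw⟩ := hother w
      exact hdis u v z w huv hzw hzv hwu
        ((hor z hz hzu hzv).1.resolve_right (hA0 z hz hzu hzv)) hc
    constructor
    · intro a ha
      rcases hcA a ha with rfl | ⟨w, hw, hwu, hwv, rfl | rfl⟩
      · simp
      · simp
      · exact absurd ha (hA0 w hw hwu hwv)
    · intro a ha
      rcases hcB a ha with rfl | ⟨w, hw, hwu, hwv, rfl | rfl⟩
      · simp
      · simp
      · exact absurd ha (hB0 w hw hwu hwv)
  obtain ⟨y, hy, hyx, hyn⟩ := exists_mem_notMem_pair (S := S) (a := {x}) (x := n) (by simp; omega)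
  rw [mem_singleton] at hyx
  rcases (hor y hy hyx hyn).1 with hyA | hyA
  · exact ⟨x, key x n hin hor (hcov A hA hxA) (hcov B hB hxB) ⟨y, hy, hyx, hyn, hyA⟩⟩
  · refine ⟨n, key n x hin.symm (fun z hz h1 h2 => ?_) (fun a ha => ?_)
      (fun a ha => ?_) ⟨y, hy, hyn, hyx, hyA⟩⟩
    · exact ⟨(hor z hz h2 h1).1.symm, (hor z hz h2 h1).2.symm⟩
    · rw [pair_comm]
      rcases hcov A hA hxA a ha with h | ⟨z, hz, h1, h2, h⟩
      · exact Or.inl h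
      · exact Or.inr ⟨z, hz, h2, h1, h.symm⟩
    · rw [pair_comm]
      rcases hcov B hB hxB a ha with h | ⟨z, hz, h1, h2, h⟩
      · exact Or.inl h
      · exact Or.inr ⟨z, hz, h2, h1, h.symm⟩

/-- Hilton's theorem on nonempty cross-intersecting families, with the extremal structure. -/
theorem card_add_card_le_of_nonempty_crossInt (N : ℕ) :
    ∀ (k : ℕ) (S : Finset α) (A B : Finset (Finset α)), S.card = N → 2 * k ≤ N →
      A ⊆ powersetCard k S → B ⊆ powersetCard k S → A.Nonempty → B.Nonempty → CrossInt A B →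
      A.card + B.card + (N - k).choose k ≤ N.choose k + 1 ∧
      (2 * k + 1 ≤ N → A.card + B.card + (N - k).choose k = N.choose k + 1 →
        A.card = 1 ∨ B.card = 1 ∨ k = 2 ∧ ∃ x, (∀ a ∈ A, x ∈ a) ∧ ∀ b ∈ B, x ∈ b) := by
  induction N with
  | zero =>
    intro k S A B hS hk hA hB hAne hBne h
    obtain ⟨a, ha⟩ := hAne
    obtain ⟨b, hb⟩ := hBne
    obtain ⟨x, hx, -⟩ := h a ha b hb
    have := (mem_powersetCard.1 (hA ha)).1 hx
    simp [card_eq_zero.1 hS] at this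
  | succ N IH =>
    intro k S A B hS hk hA hB hAne hBne h
    rcases hk.eq_or_lt with hk' | hk'
    · have := card_add_card_le_of_crossInt (hS.trans hk'.symm) hA hB h
      have e : N + 1 - k = k := by omega
      rw [e, ← hk', Nat.choose_self]
      exact ⟨by omega, by omega⟩
    obtain rfl | rfl | ⟨l, rfl⟩ : k = 0 ∨ k = 1 ∨ ∃ l, k = l + 2 := by
      obtain _ | _ | l := k
      exacts [Or.inl rfl, Or.inr (Or.inl rfl), Or.inr (Or.inr ⟨l, rfl⟩)]
    · obtain ⟨a, ha⟩ := hAne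
      obtain ⟨b, hb⟩ := hBne
      obtain ⟨x, hx, -⟩ := h a ha b hb
      have := (mem_powersetCard.1 (hA ha)).2
      rw [card_eq_zero.1 this] at hx
      simp at hx
    · have h1 := cross_singletons hA hB hAne hBne h
      have h2 := cross_singletons hB hA hBne hAne h.symm
      simp only [Nat.choose_one_right]
      exact ⟨by omega, fun _ _ => Or.inl h1⟩
    · obtain ⟨n, hn⟩ : S.Nonempty := by rw [← card_pos]; omega
      have hT : (S.erase n).card = N := by rw [card_erase_of_mem hn]; omega
      induction hd : (A.filter (n ∈ ·)).card + (B.filter (n ∈ ·)).card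
        using Nat.strong_induction_on generalizing A B with
      | _ d ih =>
      by_cases hst : Stable n S A ∧ Stable n S B
      · have := cross_stable hn (by omega) hA hB hAne hBne h hst.1 hst.2
          (fun k A B h1 h2 h3 h4 h5 h6 => by
            have := (IH k _ A B hT (by omega) h2 h3 h4 h5 h6).1
            rwa [hS, Nat.add_sub_cancel])
        rw [hS] at this
        refine ⟨this.1, fun _ heq => ?_⟩
        rcases this.2 heq with h | h | ⟨h, h'⟩
        · exact Or.inl h
        · exact Or.inr (Or.inl h)
        · exact Or.inr (Or.inr ⟨by omega, h'⟩)
      · obtain ⟨i, hi, hin, hlt⟩ : ∃ i ∈ S, i ≠ n ∧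
            ((shift i n A).filter (n ∈ ·)).card + ((shift i n B).filter (n ∈ ·)).card < d := by
          rw [not_and_or] at hst
          simp only [Stable, not_forall] at hst
          obtain ⟨a, ha, hna, i, hi, hia, h⟩ | ⟨a, ha, hna, i, hi, hia, h⟩ := hst
          · have hin : i ≠ n := by rintro rfl; exact hia hna
            have h1 := degree_shift_lt ha hna hia h
            have h2 := degree_shift_le B hin
            exact ⟨i, hi, hin, by omega⟩
          · have hin : i ≠ n := by rintro rfl; exact hia hna
            have h1 := degree_shift_lt ha hna hia h
            have h2 := degree_shift_le A hin
            exact ⟨i, hi, hin, by omega⟩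
        have key := ih _ hlt (shift i n A) (shift i n B)
          (by rw [← card_pos, card_shift]; exact hAne.card_pos)
          (by rw [← card_pos, card_shift]; exact hBne.card_pos) h.shift
          (shift_subset hi hA) (shift_subset hi hB) rfl
        rw [card_shift, card_shift] at key
        refine ⟨key.1, fun hk heq => ?_⟩
        rcases key.2 hk heq with h' | h' | ⟨hl, x, hxA, hxB⟩
        · exact Or.inl h'
        · exact Or.inr (Or.inl h')
        · obtain rfl : l = 0 := by omega
          refine Or.inr (Or.inr ⟨hl, ?_⟩)
          exact star_of_shift_star hi hn hin (by omega) hA hB hAne h (by rw [hS]; exact heq)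
            hxA hxB

end

section

/-- No element is common to all members of `F`. -/
def NoCenter {α : Type*} (F : Finset (Finset α)) : Prop :=
  ∀ x, ∃ a ∈ F, x ∉ a

/-- All members of `F` but one contain a common element. -/
def AlmostStar {α : Type*} (F : Finset (Finset α)) : Prop :=
  ∃ x, ∃ K ∈ F, x ∉ K ∧ ∀ a ∈ F, a ≠ K → x ∈ a

/-- All members of `F` contain at least two elements of a fixed triple. -/
def TripleLike {α : Type*} (F : Finset (Finset α)) : Prop :=
  ∃ x y z, x ≠ y ∧ x ≠ z ∧ y ≠ z ∧
    ∀ a ∈ F, (x ∈ a ∧ y ∈ a) ∨ (x ∈ a ∧ z ∈ a) ∨ (y ∈ a ∧ z ∈ a)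

/-- Some pair of elements meets every member of `F`. -/
def PairCovered {α : Type*} (F : Finset (Finset α)) : Prop :=
  ∃ x y, x ≠ y ∧ ∀ a ∈ F, x ∈ a ∨ y ∈ a

variable {α : Type*} [DecidableEq α]

theorem PairCovered.bound {l : ℕ} {S : Finset α} {F : Finset (Finset α)}
    (hS : 2 * (l + 2) + 1 ≤ S.card) (hF : F ⊆ powersetCard (l + 2) S) (h : CrossInt F F)
    (hnc : NoCenter F) (hcov : PairCovered F) :
    F.card + (S.card - (l + 3)).choose (l + 1) ≤ (S.card - 1).choose (l + 1) + 1 ∧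
      (F.card + (S.card - (l + 3)).choose (l + 1) = (S.card - 1).choose (l + 1) + 1 →
        AlmostStar F ∨ l = 1 ∧ TripleLike F) := by
  obtain ⟨x, y, hxy, hcov⟩ := hcov
  obtain ⟨a, ha, hya⟩ := hnc y
  have hxa := (hcov a ha).resolve_right hya
  obtain ⟨b, hb, hxb⟩ := hnc x
  have hyb := (hcov b hb).resolve_left hxb
  have hxS : x ∈ S := (mem_powersetCard.1 (hF ha)).1 hxa
  have hyS : y ∈ S := (mem_powersetCard.1 (hF hb)).1 hyb
  set T := (S.erase x).erase y with hTdef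
  have hT : T.card = S.card - 2 := by
    rw [hTdef, card_erase_of_mem (by simp [hxy.symm, hyS]), card_erase_of_mem hxS]; omega
  set Fx := (F.memberSubfamily x).nonMemberSubfamily y with hFx
  set Fy := (F.nonMemberSubfamily x).memberSubfamily y with hFy
  set Fxy := (F.memberSubfamily x).memberSubfamily y with hFxy
  have hxs : Fx ⊆ powersetCard (l + 1) T := nonMemberSubfamily_subset (memberSubfamily_subset hF)
  have hys : Fy ⊆ powersetCard (l + 1) T := memberSubfamily_subset (nonMemberSubfamily_subset hF)
  have hxys : Fxy ⊆ powersetCard l T := memberSubfamily_subset (memberSubfamily_subset hF)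
  have h0 : (F.nonMemberSubfamily x).nonMemberSubfamily y = ∅ := by
    refine eq_empty_of_forall_notMem fun c hc => ?_
    simp only [mem_nonMemberSubfamily] at hc
    have := hcov c hc.1.1
    tauto
  have mem_x : ∀ c ∈ F, y ∉ c → c.erase x ∈ Fx := by
    intro c hc hyc
    have hxc := (hcov c hc).resolve_right hyc
    simp [hFx, insert_erase hxc, hc, hyc]
  have mem_y : ∀ c ∈ F, x ∉ c → c.erase y ∈ Fy := by
    intro c hc hxc
    have hyc := (hcov c hc).resolve_left hxc
    simp [hFy, insert_erase hyc, hc, hxc]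
  have c1 := card_memberSubfamily_add_card_nonMemberSubfamily x F
  have c2 := card_memberSubfamily_add_card_nonMemberSubfamily y (F.memberSubfamily x)
  have c3 := card_memberSubfamily_add_card_nonMemberSubfamily y (F.nonMemberSubfamily x)
  rw [h0, card_empty] at c3
  rw [← hFx, ← hFxy] at c2
  rw [← hFy] at c3
  have c4 := card_le_card hxys
  rw [card_powersetCard, hT] at c4
  have hcross : CrossInt Fx Fy := by
    intro c hc d hd
    simp only [hFx, hFy, mem_nonMemberSubfamily, mem_memberSubfamily] at hc hd
    obtain ⟨z, hz, hz'⟩ := h _ hc.1.1 _ hd.1.1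
    grind
  have key := card_add_card_le_of_nonempty_crossInt (S.card - 2) (l + 1) T Fx Fy hT (by omega)
    hxs hys ⟨_, mem_x a ha hya⟩ ⟨_, mem_y b hb hxb⟩ hcross
  obtain ⟨m, hm⟩ : ∃ m, S.card = m + 2 := ⟨S.card - 2, by omega⟩
  have e1 : S.card - 1 = m + 1 := by omega
  have e2 : S.card - (l + 3) = m - (l + 1) := by omega
  have e3 : S.card - 2 = m := by omega
  have c5 : (m + 1).choose (l + 1) = m.choose l + m.choose (l + 1) := Nat.choose_succ_succ _ _
  rw [e3] at key c4
  rw [e1, e2]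
  refine ⟨by omega, fun heq => ?_⟩
  have huniq : ∀ {u v : α} {c d e : Finset α}, u ∈ c → u ∈ d → c.erase u = e → d.erase u = e →
      c = d := by
    intro u v c d e hc hd h1 h2
    rw [← insert_erase hc, ← insert_erase hd, h1, h2]
  rcases key.2 (by omega) (by omega) with h1 | h1 | ⟨h1, z, hzx, hzy⟩
  · obtain ⟨e, he⟩ := card_eq_one.1 h1
    refine Or.inl ⟨y, a, ha, hya, fun c hc hca => ?_⟩
    by_contra hyc
    have h2 := mem_x a ha hya
    have h3 := mem_x c hc hyc
    rw [he, mem_singleton] at h2 h3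
    exact hca (huniq (v := x) ((hcov c hc).resolve_right hyc) hxa h3 h2)
  · obtain ⟨e, he⟩ := card_eq_one.1 h1
    refine Or.inl ⟨x, b, hb, hxb, fun c hc hcb => ?_⟩
    by_contra hxc
    have h2 := mem_y b hb hxb
    have h3 := mem_y c hc hxc
    rw [he, mem_singleton] at h2 h3
    exact hcb (huniq (v := x) ((hcov c hc).resolve_left hxc) hyb h3 h2)
  · refine Or.inr ⟨by omega, x, y, z, hxy, ?_, ?_, fun c hc => ?_⟩
    · rintro rfl
      simpa using hzx _ (mem_x a ha hya)
    · rintro rfl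
      simpa using hzy _ (mem_y b hb hxb)
    · by_cases hyc : y ∈ c
      · by_cases hxc : x ∈ c
        · exact Or.inl ⟨hxc, hyc⟩
        · exact Or.inr (Or.inr ⟨hyc, mem_of_mem_erase (hzy _ (mem_y c hc hxc))⟩)
      · exact Or.inr (Or.inl ⟨(hcov c hc).resolve_right hyc,
          mem_of_mem_erase (hzx _ (mem_x c hc hyc))⟩)

theorem NoCenter.nonMemberSubfamily {k : ℕ} {n : α} {S : Finset α} {F : Finset (Finset α)}
    (hF : F ⊆ powersetCard k S) (hk : k + 1 < S.card) (hst : Stable n S F) (hnc : NoCenter F) :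
    NoCenter (F.nonMemberSubfamily n) := by
  intro x
  obtain ⟨a, ha, hxa⟩ := hnc x
  by_cases hna : n ∈ a
  · obtain ⟨i, hi, hia, hix⟩ := exists_mem_notMem_pair (S := S) (a := a) (x := x)
      (by rw [(mem_powersetCard.1 (hF ha)).2]; exact hk)
    refine ⟨_, mem_nonMemberSubfamily.2 ⟨hst a ha hna i hi hia, ?_⟩, ?_⟩
    · have : n ≠ i := by rintro rfl; exact hia hna
      simp [this]
    · simp [hix.symm, hxa]
  · exact ⟨a, mem_nonMemberSubfamily.2 ⟨ha, hna⟩, hxa⟩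

theorem link_bound_of_star {l : ℕ} {n x : α} {S : Finset α} {F : Finset (Finset α)}
    (hn : n ∈ S) (hxS : x ∈ S) (hxn : x ≠ n) (hS : 2 * (l + 3) + 1 ≤ S.card)
    (hF : F ⊆ powersetCard (l + 3) S)
    (h : CrossInt F F) (hnc : NoCenter F) (hst : Stable n S F)
    (hx : ∀ a ∈ F.memberSubfamily n, x ∈ a) :
    (F.memberSubfamily n).card + (S.card - 2 - (l + 3)).choose (l + 1)
        ≤ (S.card - 2).choose (l + 1) ∧
      ((F.memberSubfamily n).card + (S.card - 2 - (l + 3)).choose (l + 1)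
        = (S.card - 2).choose (l + 1) → AlmostStar F) := by
  obtain ⟨K, hK, hxK⟩ := NoCenter.nonMemberSubfamily hF (by omega) hst hnc x
  set G := (F.memberSubfamily n).memberSubfamily x with hGdef
  set T := (S.erase n).erase x with hTdef
  have hT : T.card = S.card - 2 := by
    rw [hTdef, card_erase_of_mem (by simp [hxn, hxS]), card_erase_of_mem hn]; omega
  have hG : G ⊆ powersetCard (l + 1) T := memberSubfamily_subset (memberSubfamily_subset hF)
  have hGc : G.card = (F.memberSubfamily n).card := by
    rw [← card_memberSubfamily_add_card_nonMemberSubfamily x (F.memberSubfamily n), ← hGdef,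
      left_eq_add, card_eq_zero]
    refine eq_empty_of_forall_notMem fun a ha => ?_
    rw [mem_nonMemberSubfamily] at ha
    exact ha.2 (hx a ha.1)
  have hmeet : ∀ L ∈ F, n ∉ L → x ∉ L → ∀ g ∈ G, ∃ y ∈ g, y ∈ L := by
    intro L hL hnL hxL g hg
    simp only [hGdef, mem_memberSubfamily] at hg
    obtain ⟨y, hy, hy'⟩ := h _ hg.1.1 _ hL
    grind
  have hsub : ∀ L ∈ F, n ∉ L → x ∉ L → L ⊆ T ∧ L.card = l + 3 := fun L hL hnL hxL =>
    have h := mem_powersetCard.1 (hF hL)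
    ⟨subset_erase.2 ⟨subset_erase.2 ⟨h.1, hnL⟩, hxL⟩, h.2⟩
  rw [mem_nonMemberSubfamily] at hK
  have hKT := hsub K hK.1 hK.2 hxK
  have key := card_add_choose_le_of_meets hG hKT.1 (hmeet K hK.1 hK.2 hxK)
  rw [hGc, hKT.2, hT] at key
  refine ⟨key.1, fun heq => ⟨x, K, hK.1, hxK, fun L hL hLK => ?_⟩⟩
  have huniq : ∀ L ∈ F, n ∉ L → x ∉ L → L = K := by
    intro L hL hnL hxL
    have hLT := hsub L hL hnL hxL
    exact (eq_of_forall_meets (r := l + 1) (by omega) hKT.1 (by rw [hKT.2, hLT.2])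
      (by rw [hT, hLT.2]; omega)
      fun g hg hgK => hmeet L hL hnL hxL g (key.2 heq g hg hgK)).symm
  by_contra hxL
  by_cases hnL : n ∈ L
  · have hLc := (mem_powersetCard.1 (hF hL)).2
    have hrepl : ∀ i ∈ S, i ∉ L → i ≠ x → insert i (L.erase n) = K := by
      intro i hi hiL hix
      refine huniq _ (hst L hL hnL i hi hiL) ?_ ?_
      · have : n ≠ i := by rintro rfl; exact hiL hnL
        simp [this]
      · simp [hix.symm, hxL]
    obtain ⟨i, hi, hiL, hix⟩ := exists_mem_notMem_pair (S := S) (a := L) (x := x) (by omega)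
    obtain ⟨j, hj, hjL, hjx⟩ := exists_mem_notMem_pair (S := S) (a := insert i L) (x := x)
      (by have := card_insert_le i L; omega)
    have hij : i ∈ insert j (L.erase n) := by
      rw [hrepl j hj (by grind) hjx, ← hrepl i hi hiL hix]
      simp
    grind
  · exact hLK (huniq L hL hnL hxL)

theorem bound_of_stable {l : ℕ} {n : α} {S : Finset α} {F : Finset (Finset α)}
    (hn : n ∈ S) (hS : 2 * (l + 3) + 1 ≤ S.card) (hF : F ⊆ powersetCard (l + 3) S)
    (h : CrossInt F F) (hnc : NoCenter F) (hst : Stable n S F)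
    (IH : ∀ l (F : Finset (Finset α)), 2 * (l + 1) + 1 ≤ S.card →
      F ⊆ powersetCard (l + 1) (S.erase n) → CrossInt F F → NoCenter F →
      F.card + (S.card - 1 - (l + 2)).choose l ≤ (S.card - 1 - 1).choose l + 1) :
    F.card + (S.card - (l + 4)).choose (l + 2) ≤ (S.card - 1).choose (l + 2) + 1 ∧
      (F.card + (S.card - (l + 4)).choose (l + 2) = (S.card - 1).choose (l + 2) + 1 →
        AlmostStar F ∨ PairCovered F) := by
  have h0 := IH _ _ hS (nonMemberSubfamily_subset hF)
    (fun a ha b hb => h a (mem_nonMemberSubfamily.1 ha).1 b (mem_nonMemberSubfamily.1 hb).1)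
    (NoCenter.nonMemberSubfamily hF (by omega) hst hnc)
  have hc := card_memberSubfamily_add_card_nonMemberSubfamily n F
  obtain ⟨d, hd⟩ : ∃ d, S.card = l + 4 + d + 1 := ⟨S.card - (l + 4) - 1, by omega⟩
  have e1 : S.card - (l + 4) = d + 1 := by omega
  have e2 : S.card - 1 - (l + 4) = d := by omega
  have e3 : S.card - 1 = l + 3 + d + 1 := by omega
  have e4 : S.card - 1 - (l + 3) = d + 1 := by omega
  have e5 : S.card - 2 - (l + 3) = d := by omega
  have e6 : S.card - 2 = l + 3 + d := by omega
  have e7 : S.card - 1 - 1 = l + 3 + d := by omega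
  have c1 : (d + 1).choose (l + 2) = d.choose (l + 1) + d.choose (l + 2) :=
    Nat.choose_succ_succ _ _
  have c2 : (l + 3 + d + 1).choose (l + 2)
      = (l + 3 + d).choose (l + 1) + (l + 3 + d).choose (l + 2) := Nat.choose_succ_succ _ _
  have c3 : (d + 1).choose (l + 1) = d.choose l + d.choose (l + 1) := Nat.choose_succ_succ _ _
  rw [show l + 2 + 2 = l + 4 from rfl, e2, e7] at h0
  rw [e1, e3]
  by_cases hstar : ∃ x ∈ S, x ≠ n ∧ ∀ a ∈ F.memberSubfamily n, x ∈ a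
  · obtain ⟨x, hxS, hxn, hx⟩ := hstar
    have h1 := link_bound_of_star hn hxS hxn hS hF h hnc hst hx
    rw [e5, e6] at h1
    exact ⟨by omega, fun heq => Or.inl (h1.2 (by omega))⟩
  have hne : (F.memberSubfamily n).Nonempty := by
    obtain ⟨x, hx, -, hxn⟩ := exists_mem_notMem_pair (S := S) (a := ∅) (x := n) (by simp; omega)
    by_contra hcon
    rw [not_nonempty_iff_eq_empty] at hcon
    exact hstar ⟨x, hx, hxn, by simp [hcon]⟩
  have hnc1 : NoCenter (F.memberSubfamily n) := by
    intro x
    by_contra hcon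
    push Not at hcon
    obtain ⟨a, ha⟩ := hne
    have := (mem_powersetCard.1 (memberSubfamily_subset hF ha)).1 (hcon a ha)
    rw [mem_erase] at this
    exact hstar ⟨x, this.2, this.1, hcon⟩
  have h1 := IH _ _ (by omega) (memberSubfamily_subset hF)
    (CrossInt.memberSubfamily hF hF (by omega) hst h) hnc1
  rw [show l + 1 + 2 = l + 3 from rfl, e4, e7] at h1
  have hpos := Nat.choose_pos (n := d) (k := l) (by omega)
  refine ⟨by omega, fun heq => Or.inr ?_⟩
  have hl : l = 0 := by
    by_contra hl
    have := one_lt_choose (d := d) (l := l) (by omega) (by omega)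
    omega
  subst hl
  obtain ⟨a, ha⟩ := hne
  have ha2 := (mem_powersetCard.1 (memberSubfamily_subset hF ha)).2
  obtain ⟨x, y, hxy, rfl⟩ := card_eq_two.1 ha2
  rw [mem_memberSubfamily] at ha
  refine ⟨x, y, hxy, fun b hb => ?_⟩
  by_contra hcon
  push Not at hcon
  have hb3 := (mem_powersetCard.1 (hF hb)).2
  obtain ⟨i, hi, hib, hin⟩ := exists_mem_notMem_pair (S := S) (a := insert x (insert y b)) (x := n)
    (by have := card_insert_le x (insert y b); have := card_insert_le y b; omega)
  by_cases hnb : n ∈ b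
  · obtain ⟨z, hz, hz'⟩ := h _ (hst _ ha.1 (by simp) i hi (by grind)) b hb
    grind
  · obtain ⟨z, hz, hz'⟩ := h _ ha.1 b hb
    grind

end

section

variable {α : Type*} [DecidableEq α]

theorem cover_of_cover_shift {i n x y : α} {F : Finset (Finset α)} (hx : x ≠ i) (hy : y ≠ i)
    (h : ∀ a ∈ shift i n F, x ∈ a ∨ y ∈ a) : ∀ a ∈ F, x ∈ a ∨ y ∈ a := by
  intro a ha
  rcases mem_shift_or ha with h1 | ⟨-, -, h1⟩
  · exact h a h1
  · have := h _ h1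
    grind

theorem cover_of_shift {i n : α} {F : Finset (Finset α)}
    (h : ∀ a ∈ shift i n F, i ∈ a ∨ n ∈ a) : ∀ a ∈ F, i ∈ a ∨ n ∈ a := by
  intro a ha
  rcases mem_shift_or ha with h1 | ⟨h1, -, -⟩
  · exact h a h1
  · exact Or.inr h1

theorem TripleLike.pairCovered_of_shift {i n : α} {F : Finset (Finset α)}
    (h : TripleLike (shift i n F)) : PairCovered F := by
  obtain ⟨x, y, z, hxy, hxz, hyz, h⟩ := h
  by_cases hx : x = i
  · exact ⟨y, z, hyz, cover_of_cover_shift (hx ▸ hxy.symm) (hx ▸ hxz.symm) fun a ha => by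
      have := h a ha; tauto⟩
  by_cases hy : y = i
  · exact ⟨x, z, hxz, cover_of_cover_shift hx (hy ▸ hyz.symm) fun a ha => by
      have := h a ha; tauto⟩
  · exact ⟨x, y, hxy, cover_of_cover_shift hx hy fun a ha => by
      have := h a ha; tauto⟩

/-- An almost-star centered at `i` whose exceptional member avoids both `i` and `n` can only be
the shift of an extremal family in the expected ways. -/
theorem almostStar_of_shift {l : ℕ} {i n : α} {S K : Finset α} {F : Finset (Finset α)}
    (hi : i ∈ S) (hn : n ∈ S) (hin : i ≠ n) (hS : 2 * (l + 3) + 1 ≤ S.card)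
    (hF : F ⊆ powersetCard (l + 3) S) (h : CrossInt F F)
    (heq : F.card + (S.card - (l + 4)).choose (l + 2) = (S.card - 1).choose (l + 2) + 1)
    (hK : K ∈ F) (hiK : i ∉ K) (hnK : n ∉ K) (hcov : ∀ a ∈ F, a ≠ K → i ∈ a ∨ n ∈ a) :
    AlmostStar F := by
  by_contra hcon
  obtain ⟨a, ha, haK, hia⟩ : ∃ a ∈ F, a ≠ K ∧ i ∉ a := by
    by_contra hcon'
    push Not at hcon'
    exact hcon ⟨i, K, hK, hiK, hcon'⟩
  have hna := (hcov a ha haK).resolve_left hia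
  obtain ⟨b, hb, hbK, hnb⟩ : ∃ b ∈ F, b ≠ K ∧ n ∉ b := by
    by_contra hcon'
    push Not at hcon'
    exact hcon ⟨n, K, hK, hnK, hcon'⟩
  have hib := (hcov b hb hbK).resolve_right hnb
  set T := (S.erase i).erase n with hTdef
  have hT : T.card = S.card - 2 := by
    rw [hTdef, card_erase_of_mem (by simp [hin.symm, hn]), card_erase_of_mem hi]; omega
  have hKS := mem_powersetCard.1 (hF hK)
  have hKT : K ⊆ T := subset_erase.2 ⟨subset_erase.2 ⟨hKS.1, hiK⟩, hnK⟩
  set Fi := (F.memberSubfamily i).nonMemberSubfamily n with hFi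
  set Fn := (F.nonMemberSubfamily i).memberSubfamily n with hFn
  set Fboth := (F.memberSubfamily i).memberSubfamily n with hFboth
  have his : Fi ⊆ powersetCard (l + 2) T := nonMemberSubfamily_subset (memberSubfamily_subset hF)
  have hns : Fn ⊆ powersetCard (l + 2) T := memberSubfamily_subset (nonMemberSubfamily_subset hF)
  have hins : Fboth ⊆ powersetCard (l + 1) T := memberSubfamily_subset (memberSubfamily_subset hF)
  have h0 : ((F.nonMemberSubfamily i).nonMemberSubfamily n).card ≤ 1 := by
    refine card_le_one_iff_subset_singleton.2 ⟨K, fun c hc => ?_⟩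
    simp only [mem_nonMemberSubfamily] at hc
    rw [mem_singleton]
    by_contra hne
    have := hcov c hc.1.1 hne
    tauto
  have c1 := card_memberSubfamily_add_card_nonMemberSubfamily i F
  have c2 := card_memberSubfamily_add_card_nonMemberSubfamily n (F.memberSubfamily i)
  have c3 := card_memberSubfamily_add_card_nonMemberSubfamily n (F.nonMemberSubfamily i)
  rw [← hFi, ← hFboth] at c2
  rw [← hFn] at c3
  have hmeet := (card_add_choose_le_of_meets hins hKT fun g hg => by
    simp only [hFboth, mem_memberSubfamily] at hg
    obtain ⟨y, hy, hy'⟩ := h _ hg.1.1 _ hK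
    grind).1
  rw [hKS.2, hT] at hmeet
  have hcross : CrossInt Fi Fn := by
    intro c hc d hd
    simp only [hFi, hFn, mem_nonMemberSubfamily, mem_memberSubfamily] at hc hd
    obtain ⟨z, hz, hz'⟩ := h _ hc.1.1 _ hd.1.1
    grind
  have key := (card_add_card_le_of_nonempty_crossInt (S.card - 2) (l + 2) T Fi Fn hT (by omega)
    his hns ⟨b.erase i, by simp [hFi, insert_erase hib, hb, hnb]⟩
    ⟨a.erase n, by simp [hFn, insert_erase hna, ha, hia]⟩ hcross).1
  obtain ⟨m, hm⟩ : ∃ m, S.card = m + 2 := ⟨S.card - 2, by omega⟩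
  have e1 : S.card - 1 = m + 1 := by omega
  have e2 : S.card - (l + 4) = m - (l + 2) := by omega
  have e3 : S.card - 2 = m := by omega
  have c4 : (m + 1).choose (l + 2) = m.choose (l + 1) + m.choose (l + 2) :=
    Nat.choose_succ_succ _ _
  have c5 := one_lt_choose (d := m - (l + 3)) (l := l + 1) (by omega) (by omega)
  rw [e3] at key hmeet
  rw [e1, e2] at heq
  omega

theorem AlmostStar.of_shift {l : ℕ} {i n : α} {S : Finset α} {F : Finset (Finset α)}
    (hi : i ∈ S) (hn : n ∈ S) (hin : i ≠ n) (hS : 2 * (l + 3) + 1 ≤ S.card)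
    (hF : F ⊆ powersetCard (l + 3) S) (h : CrossInt F F)
    (heq : F.card + (S.card - (l + 4)).choose (l + 2) = (S.card - 1).choose (l + 2) + 1)
    (hnc : NoCenter (shift i n F)) (hG : AlmostStar (shift i n F)) :
    AlmostStar F ∨ PairCovered F := by
  have hsub := shift_subset (n := n) hi hF
  have main : ∀ K ∈ shift i n F, i ∉ K → (∀ a ∈ shift i n F, a ≠ K → i ∈ a) →
      AlmostStar F ∨ PairCovered F := by
    intro K hK hiK hcov
    by_cases hnK : n ∈ K
    · refine Or.inr ⟨i, n, hin, cover_of_shift fun a ha => ?_⟩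
      by_cases haK : a = K
      · exact Or.inr (haK ▸ hnK)
      · exact Or.inl (hcov a ha haK)
    · have hKF : K ∈ F := by
        obtain ⟨h1, -⟩ | ⟨a, -, -, -, rfl⟩ := of_mem_shift hK
        · exact h1
        · simp at hiK
      refine Or.inl (almostStar_of_shift hi hn hin hS hF h heq hKF hiK hnK fun a ha haK => ?_)
      rcases mem_shift_or ha with h1 | ⟨h1, -, -⟩
      · exact Or.inl (hcov a h1 haK)
      · exact Or.inr h1
  obtain ⟨x, K, hK, hxK, hcov⟩ := hG
  by_cases hxi : x = i
  · subst hxi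
    exact main K hK hxK hcov
  by_cases hxn : x = n
  · subst hxn
    have hback : ∀ a ∈ shift i x F, i ∉ a → a ≠ K → insert i (a.erase x) = K := by
      intro a ha hia haK
      by_contra hne
      have := hcov _ (shift_closed ha (hcov a ha haK) hia) hne
      simp [hin.symm] at this
    obtain ⟨a, ha, hia⟩ := hnc i
    by_cases hex : ∃ a ∈ shift i x F, i ∉ a ∧ a ≠ K
    · obtain ⟨a, ha, hia, haK⟩ := hex
      have hiK : i ∈ K := by
        rw [← hback a ha hia haK]
        simp
      refine main a ha hia fun b hb hba => ?_
      by_contra hib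
      have hbK : b ≠ K := by rintro rfl; exact hib hiK
      apply hba
      have h1 := (hback a ha hia haK).trans (hback b hb hib hbK).symm
      have h2 := congrArg (fun s => insert x (s.erase i)) h1
      rwa [erase_insert (by simp [hia]), erase_insert (by simp [hib]),
        insert_erase (hcov a ha haK), insert_erase (hcov b hb hbK), eq_comm] at h2
    · push Not at hex
      refine main a ha hia fun b hb hba => ?_
      by_contra hib
      exact hba ((hex b hb hib).trans (hex a ha hia).symm)
  · obtain ⟨y, hy, hyi, hyn⟩ := exists_mem_notMem_pair (S := K) (a := {i}) (x := n)
      (by rw [(mem_powersetCard.1 (hsub hK)).2]; simp)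
    rw [mem_singleton] at hyi
    refine Or.inr ⟨x, y, fun e => hxK (e ▸ hy), cover_of_cover_shift (n := n) hxi hyi fun a ha => ?_⟩
    by_cases haK : a = K
    · exact Or.inr (haK ▸ hy)
    · exact Or.inl (hcov a ha haK)

theorem pairCovered_of_shift_center {i n x : α} {F : Finset (Finset α)} (hin : i ≠ n)
    (hnc : NoCenter F) (hx : ∀ a ∈ shift i n F, x ∈ a) : PairCovered F := by
  by_cases hxi : x = i ∨ x = n
  · refine ⟨i, n, hin, cover_of_shift fun a ha => ?_⟩
    rcases hxi with rfl | rfl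
    · exact Or.inl (hx a ha)
    · exact Or.inr (hx a ha)
  · push Not at hxi
    obtain ⟨a, ha, hxa⟩ := hnc x
    have := cover_of_cover_shift hxi.1 hxi.1 (fun a ha => Or.inl (hx a ha)) a ha
    tauto

/-- The Hilton–Milner bound with the structure of the extremal families. -/
theorem card_le_of_noCenter (N : ℕ) :
    ∀ (l : ℕ) (S : Finset α) (F : Finset (Finset α)), S.card = N → 2 * (l + 1) ≤ N →
      F ⊆ powersetCard (l + 1) S → CrossInt F F → NoCenter F →
      F.card + (N - (l + 2)).choose l ≤ (N - 1).choose l + 1 ∧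
      (2 * (l + 1) + 1 ≤ N → F.card + (N - (l + 2)).choose l = (N - 1).choose l + 1 →
        AlmostStar F ∨ l = 2 ∧ TripleLike F) := by
  induction N with
  | zero => intro l S F hS hk; omega
  | succ N IH =>
    intro l S F hS hk hF h hnc
    rcases hk.eq_or_lt with hk' | hk'
    · have h1 := card_add_card_le_of_crossInt (hS.trans hk'.symm) hF hF h
      have c1 : (2 * (l + 1)).choose (l + 1) = (2 * l + 1).choose l + (2 * l + 1).choose (l + 1) :=
        Nat.choose_succ_succ _ _
      have c2 := Nat.choose_symm_half l
      rw [show N + 1 - 1 = 2 * l + 1 by omega, show N + 1 - (l + 2) = l by omega, Nat.choose_self]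
      exact ⟨by omega, by omega⟩
    have hScard : 2 * (l + 1) + 1 ≤ S.card := by omega
    have hcovered : 1 ≤ l → ∀ F ⊆ powersetCard (l + 1) S, CrossInt F F → NoCenter F →
        PairCovered F → F.card + (N + 1 - (l + 2)).choose l ≤ (N + 1 - 1).choose l + 1 ∧
        (2 * (l + 1) + 1 ≤ N + 1 →
          F.card + (N + 1 - (l + 2)).choose l = (N + 1 - 1).choose l + 1 →
          AlmostStar F ∨ l = 2 ∧ TripleLike F) := by
      intro hl F hF h hnc hcov
      obtain ⟨l, rfl⟩ := Nat.exists_eq_succ_of_ne_zero (by omega : l ≠ 0)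
      have := hcov.bound hScard hF h hnc
      rw [hS] at this
      exact ⟨this.1, fun _ heq => (this.2 heq).imp_right fun h => ⟨by omega, h.2⟩⟩
    obtain ⟨n, hn⟩ : S.Nonempty := by rw [← card_pos]; omega
    obtain rfl | rfl | ⟨l, rfl⟩ : l = 0 ∨ l = 1 ∨ ∃ m, l = m + 2 := by
      obtain _ | _ | l := l
      exacts [Or.inl rfl, Or.inr (Or.inl rfl), Or.inr (Or.inr ⟨l, rfl⟩)]
    · obtain ⟨a, ha, -⟩ := hnc n
      obtain ⟨x, rfl⟩ := card_eq_one.1 (mem_powersetCard.1 (hF ha)).2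
      obtain ⟨b, hb, hxb⟩ := hnc x
      obtain ⟨y, hy, hyb⟩ := h _ ha b hb
      rw [mem_singleton] at hy
      exact absurd (hy ▸ hyb) hxb
    · obtain ⟨a, ha, -⟩ := hnc n
      obtain ⟨x, y, hxy, rfl⟩ := card_eq_two.1 (mem_powersetCard.1 (hF ha)).2
      refine hcovered le_rfl F hF h hnc ⟨x, y, hxy, fun b hb => ?_⟩
      obtain ⟨z, hz, hzb⟩ := h _ ha b hb
      rw [mem_insert, mem_singleton] at hz
      rcases hz with rfl | rfl
      · exact Or.inl hzb
      · exact Or.inr hzb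
    · have hcovered := hcovered (by omega)
      have hT : (S.erase n).card = N := by rw [card_erase_of_mem hn]; omega
      induction hd : (F.filter (n ∈ ·)).card using Nat.strong_induction_on generalizing F with
      | _ d ih =>
      by_cases hst : Stable n S F
      · have key := bound_of_stable hn (by omega) hF h hnc hst
          (fun l F h1 h2 h3 h4 => by
            have := (IH l _ F hT (by omega) h2 h3 h4).1
            rwa [hS, Nat.add_sub_cancel])
        rw [hS] at key
        refine ⟨key.1, fun hN heq => ?_⟩
        rcases key.2 heq with h1 | h1
        · exact Or.inl h1
        · exact (hcovered F hF h hnc h1).2 hN heq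
      · simp only [Stable, not_forall] at hst
        obtain ⟨a, ha, hna, i, hi, hia, hnot⟩ := hst
        have hin : i ≠ n := by rintro rfl; exact hia hna
        by_cases hncG : NoCenter (shift i n F)
        · have key := ih _ (hd ▸ degree_shift_lt ha hna hia hnot) (shift i n F)
            h.shift hncG (shift_subset hi hF) rfl
          rw [card_shift] at key
          refine ⟨key.1, fun hN heq => ?_⟩
          rcases key.2 hN heq with h1 | ⟨-, h1⟩
          · rcases AlmostStar.of_shift hi hn hin (by omega) hF h (by rw [hS]; exact heq) hncG h1
              with h2 | h2
            · exact Or.inl h2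
            · exact (hcovered F hF h hnc h2).2 hN heq
          · exact (hcovered F hF h hnc h1.pairCovered_of_shift).2 hN heq
        · simp only [NoCenter, not_forall, not_exists, not_and, not_not] at hncG
          obtain ⟨x, hx⟩ := hncG
          exact hcovered F hF h hnc (pairCovered_of_shift_center hin hnc hx)

end

section

theorem card_filter_meets {α : Type*} [DecidableEq α] {T K : Finset α} (r : ℕ) (hK : K ⊆ T) :
    ((powersetCard r T).filter fun g => (g ∩ K).Nonempty).card + (T.card - K.card).choose r
      = T.card.choose r := by
  have h : (powersetCard r T).filter (fun g => ¬ (g ∩ K).Nonempty) = powersetCard r (T \ K) := by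
    ext g
    rw [mem_filter, mem_powersetCard, mem_powersetCard, subset_sdiff, not_nonempty_iff_eq_empty,
      disjoint_iff_inter_eq_empty]
    tauto
  rw [← card_sdiff_of_subset hK, ← card_powersetCard, ← card_powersetCard, ← h]
  exact card_filter_add_card_filter_not _

theorem exists_perm_mem_iff {α : Type*} [DecidableEq α] (A B : Finset α) (h : A.card = B.card) :
    ∃ σ : Equiv.Perm α, (∀ x, x ∉ A ∪ B → σ x = x) ∧ ∀ x, σ x ∈ B ↔ x ∈ A := by
  induction hd : (A \ B).card generalizing A with
  | zero =>
    have hAB := sdiff_eq_empty_iff_subset.1 (card_eq_zero.1 hd)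
    obtain rfl := eq_of_subset_of_card_le hAB h.ge
    exact ⟨1, by simp, by simp⟩
  | succ d ih =>
    obtain ⟨a, ha⟩ : (A \ B).Nonempty := by rw [← card_pos]; omega
    obtain ⟨b, hb⟩ : (B \ A).Nonempty := by
      rw [← card_pos, ← (card_sdiff_comm h)]; omega
    rw [mem_sdiff] at ha hb
    have hab : a ≠ b := by rintro rfl; exact ha.2 hb.1
    obtain ⟨σ, h1, h2⟩ := ih (insert b (A.erase a))
      (by rw [card_insert_of_notMem (by simp [hb.2]), card_erase_add_one ha.1, h])
      (by
        rw [insert_sdiff_of_mem _ hb.1, erase_sdiff_comm, card_erase_of_mem (mem_sdiff.2 ha), hd, Nat.add_sub_cancel])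
    refine ⟨σ * Equiv.swap a b, fun x hx => ?_, fun x => ?_⟩
    · rw [Equiv.Perm.mul_apply, Equiv.swap_apply_of_ne_of_ne (by grind) (by grind)]
      exact h1 x (by grind)
    · rw [Equiv.Perm.mul_apply, h2]
      by_cases hxa : x = a
      · simp [hxa, ha.1]
      by_cases hxb : x = b
      · simp [hxb, hab, hb.2]
      rw [Equiv.swap_apply_of_ne_of_ne hxa hxb]
      simp [hxa, hxb]

theorem mem_of_forall_fixed {α : Type*} {S : Finset α} {σ : Equiv.Perm α}
    (h : ∀ x, x ∉ S → σ x = x) {x : α} (hx : x ∈ S) : σ x ∈ S := by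
  by_contra hcon
  have h1 := σ.injective (h _ hcon)
  exact hcon (h1.symm ▸ hx)

theorem card_image_image {α : Type*} [DecidableEq α] (σ : Equiv.Perm α) (F : Finset (Finset α)) :
    (F.image fun s => s.image fun x => σ x).card = F.card :=
  card_image_of_injective _ (image_injective σ.injective)

theorem card_eq_of_isoTo {n : ℕ} {F G : Finset (Finset ℕ)} (h : IsoTo n F G) :
    F.card = G.card := by
  obtain ⟨σ, -, rfl⟩ := h
  exact (card_image_image σ F).symm

theorem isoTo_of_forall_mem {n : ℕ} {F G : Finset (Finset ℕ)} (σ : Equiv.Perm ℕ)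
    (hσ : ∀ x ∈ Icc 1 n, σ x ∈ Icc 1 n) (h : ∀ a ∈ F, a.image (fun x => σ x) ∈ G)
    (hc : G.card ≤ F.card) : IsoTo n F G :=
  ⟨σ, hσ, eq_of_subset_of_card_le (image_subset_iff.2 h) (by rwa [card_image_image])⟩

theorem image_mem_powersetCard {k : ℕ} {S a : Finset ℕ} {σ : Equiv.Perm ℕ}
    (hσ : ∀ x ∈ S, σ x ∈ S) (ha : a ∈ powersetCard k S) :
    a.image (fun x => σ x) ∈ powersetCard k S := by
  rw [mem_powersetCard] at ha ⊢
  exact ⟨image_subset_iff.2 fun x hx => hσ x (ha.1 hx),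
    by rw [card_image_of_injective _ σ.injective, ha.2]⟩

theorem card_HMfam {l n : ℕ} (hn : l + 2 ≤ n) :
    (HMfam n (l + 1)).card + (n - (l + 2)).choose l = (n - 1).choose l + 1 := by
  have hK : Icc 2 (l + 1 + 1) ⊆ Icc 2 n := Icc_subset_Icc_right hn
  have himg : (powersetCard (l + 1) (Icc 1 n)).filter
      (fun A => 1 ∈ A ∧ (A ∩ Icc 2 (l + 1 + 1)).Nonempty)
      = ((powersetCard l (Icc 2 n)).filter fun g => (g ∩ Icc 2 (l + 1 + 1)).Nonempty).image
        (insert 1) := by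
    ext A
    simp only [mem_filter, mem_image, mem_powersetCard]
    constructor
    · rintro ⟨⟨hA, hc⟩, h1, x, hx⟩
      refine ⟨A.erase 1, ⟨⟨fun y hy => ?_, ?_⟩, x, ?_⟩, insert_erase h1⟩
      · have := mem_Icc.1 (hA (mem_of_mem_erase hy))
        have := ne_of_mem_erase hy
        rw [mem_Icc]
        omega
      · rw [card_erase_of_mem h1, hc, Nat.add_sub_cancel]
      · simp only [mem_inter, mem_Icc, mem_erase] at hx ⊢
        exact ⟨⟨by omega, hx.1⟩, hx.2⟩
    · rintro ⟨g, ⟨⟨hg, hc⟩, x, hx⟩, rfl⟩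
      have h1 : 1 ∉ g := fun h => by have := mem_Icc.1 (hg h); omega
      refine ⟨⟨insert_subset (by rw [mem_Icc]; omega)
        (hg.trans (Icc_subset_Icc_left one_le_two)), ?_⟩, mem_insert_self _ _, x, ?_⟩
      · rw [card_insert_of_notMem h1, hc]
      · rw [mem_inter] at hx ⊢
        exact ⟨mem_insert_of_mem hx.1, hx.2⟩
  have hinj : Set.InjOn (insert 1) ((powersetCard l (Icc 2 n)).filter
      fun g => (g ∩ Icc 2 (l + 1 + 1)).Nonempty : Set (Finset ℕ)) := by
    have hnot : ∀ g ∈ (powersetCard l (Icc 2 n)).filter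
        (fun g => (g ∩ Icc 2 (l + 1 + 1)).Nonempty), 1 ∉ g := by
      intro g hg h
      have := mem_Icc.1 ((mem_powersetCard.1 (mem_filter.1 hg).1).1 h)
      omega
    intro g hg g' hg' heq
    rw [← erase_insert (hnot g hg), ← erase_insert (hnot g' hg'), heq]
  have key := card_filter_meets l hK
  simp only [Nat.card_Icc] at key
  rw [HMfam, card_insert_of_notMem (by simp), himg, card_image_of_injOn hinj]
  rw [show n + 1 - 2 = n - 1 by omega, show n - 1 - (l + 1 + 1 + 1 - 2) = n - (l + 2) by omega]
    at key
  omega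

theorem mem_Tfam_of_pair {n u v : ℕ} {a : Finset ℕ} (ha : a ∈ powersetCard 3 (Icc 1 n))
    (huv : u ≠ v) (hu : u ∈ Icc 1 3) (hv : v ∈ Icc 1 3) (hua : u ∈ a) (hva : v ∈ a) :
    a ∈ Tfam n :=
  mem_filter.2 ⟨ha, one_lt_card.2 ⟨u, mem_inter.2 ⟨hua, hu⟩, v, mem_inter.2 ⟨hva, hv⟩, huv⟩⟩

theorem card_Tfam {n : ℕ} (hn : 4 ≤ n) :
    (Tfam n).card + (n - 4).choose 2 = (n - 1).choose 2 + 1 := by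
  have hT : Tfam n = ((Icc 3 n).image fun z => {1, 2, z}) ∪
      (((Icc 4 n).image fun z => {1, 3, z}) ∪ ((Icc 4 n).image fun z => {2, 3, z})) := by
    ext a
    constructor
    · intro ha
      obtain ⟨ha, hc⟩ := mem_filter.1 ha
      obtain ⟨haS, hac⟩ := mem_powersetCard.1 ha
      have hthird : ∀ u v : ℕ, u ≠ v → u ∈ a → v ∈ a →
          ∃ z, z ≠ u ∧ z ≠ v ∧ 1 ≤ z ∧ z ≤ n ∧ a = {u, v, z} := by
        intro u v huv hu hv
        obtain ⟨z, hz⟩ := (card_eq_one (s := (a.erase u).erase v)).1 (by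
          rw [card_erase_of_mem (mem_erase.2 ⟨huv.symm, hv⟩), card_erase_of_mem hu, hac])
        have hza : z ∈ (a.erase u).erase v := hz ▸ mem_singleton_self z
        have h1 := mem_Icc.1 (haS (mem_of_mem_erase (mem_of_mem_erase hza)))
        refine ⟨z, by grind, by grind, h1.1, h1.2, ?_⟩
        rw [← hz, insert_erase (mem_erase.2 ⟨huv.symm, hv⟩), insert_erase hu]
      have hpair : (1 ∈ a ∧ 2 ∈ a) ∨ (1 ∈ a ∧ 3 ∈ a ∧ 2 ∉ a) ∨ (2 ∈ a ∧ 3 ∈ a ∧ 1 ∉ a) := by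
        obtain ⟨u, hu, v, hv, huv⟩ := one_lt_card.1 hc
        simp only [mem_inter, mem_Icc] at hu hv
        obtain ⟨hu, hu1, hu2⟩ := hu
        obtain ⟨hv, hv1, hv2⟩ := hv
        interval_cases u <;> interval_cases v <;> tauto
      simp only [mem_union, mem_image, mem_Icc]
      rcases hpair with ⟨h1, h2⟩ | ⟨h1, h2, h3⟩ | ⟨h1, h2, h3⟩
      · obtain ⟨z, hz1, hz2, hz3, hz4, rfl⟩ := hthird 1 2 (by omega) h1 h2
        exact Or.inl ⟨z, by omega, rfl⟩
      · obtain ⟨z, hz1, hz2, hz3, hz4, rfl⟩ := hthird 1 3 (by omega) h1 h2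
        have : z ≠ 2 := by rintro rfl; simp at h3
        exact Or.inr (Or.inl ⟨z, by omega, rfl⟩)
      · obtain ⟨z, hz1, hz2, hz3, hz4, rfl⟩ := hthird 2 3 (by omega) h1 h2
        have : z ≠ 1 := by rintro rfl; simp at h3
        exact Or.inr (Or.inr ⟨z, by omega, rfl⟩)
    · have hmem : ∀ u v z : ℕ, 1 ≤ u → u < v → v ≤ 3 → v < z → z ≤ n →
          ({u, v, z} : Finset ℕ) ∈ Tfam n := by
        intro u v z hu huv hv hvz hz
        refine mem_Tfam_of_pair (u := u) (v := v) (mem_powersetCard.2 ⟨?_, ?_⟩) huv.ne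
          (by rw [mem_Icc]; omega) (by rw [mem_Icc]; omega) (by simp) (by simp)
        · intro w hw
          simp only [mem_insert, mem_singleton] at hw
          rw [mem_Icc]
          omega
        · exact card_eq_three.2 ⟨u, v, z, by omega, by omega, by omega, rfl⟩
      simp only [mem_union, mem_image, mem_Icc]
      rintro (⟨z, hz, rfl⟩ | ⟨z, hz, rfl⟩ | ⟨z, hz, rfl⟩)
      · exact hmem 1 2 z (by omega) (by omega) (by omega) (by omega) (by omega)
      · exact hmem 1 3 z (by omega) (by omega) (by omega) (by omega) (by omega)
      · exact hmem 2 3 z (by omega) (by omega) (by omega) (by omega) (by omega)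
  have hinj : ∀ u v m : ℕ, u < m → v < m →
      Set.InjOn (fun z => ({u, v, z} : Finset ℕ)) (Icc m n) := by
    intro u v m hu hv z hz w hw h
    simp only [coe_Icc, Set.mem_Icc] at hz hw
    have h1 : z ∈ ({u, v, w} : Finset ℕ) := by
      rw [← show ({u, v, z} : Finset ℕ) = {u, v, w} from h]
      simp
    simp only [mem_insert, mem_singleton] at h1
    omega
  have hd1 : Disjoint ((Icc 4 n).image fun z => ({1, 3, z} : Finset ℕ))
      ((Icc 4 n).image fun z => {2, 3, z}) := by
    rw [Finset.disjoint_left]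
    intro a ha ha'
    obtain ⟨z, hz, rfl⟩ := mem_image.1 ha
    obtain ⟨w, hw, h⟩ := mem_image.1 ha'
    have h1 : 1 ∈ ({2, 3, w} : Finset ℕ) := h ▸ by simp
    simp only [mem_insert, mem_singleton, mem_Icc] at h1 hw
    omega
  have hd2 : Disjoint ((Icc 3 n).image fun z => ({1, 2, z} : Finset ℕ))
      (((Icc 4 n).image fun z => {1, 3, z}) ∪ ((Icc 4 n).image fun z => {2, 3, z})) := by
    rw [Finset.disjoint_left]
    intro a ha ha'
    obtain ⟨z, hz, rfl⟩ := mem_image.1 ha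
    rcases mem_union.1 ha' with ha' | ha'
    · obtain ⟨w, hw, h⟩ := mem_image.1 ha'
      have h1 : 2 ∈ ({1, 3, w} : Finset ℕ) := h ▸ by simp
      simp only [mem_insert, mem_singleton, mem_Icc] at h1 hw
      omega
    · obtain ⟨w, hw, h⟩ := mem_image.1 ha'
      have h1 : 1 ∈ ({2, 3, w} : Finset ℕ) := h ▸ by simp
      simp only [mem_insert, mem_singleton, mem_Icc] at h1 hw
      omega
  rw [hT, card_union_of_disjoint hd2, card_union_of_disjoint hd1,
    card_image_of_injOn (hinj 1 2 3 (by omega) (by omega)),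
    card_image_of_injOn (hinj 1 3 4 (by omega) (by omega)),
    card_image_of_injOn (hinj 2 3 4 (by omega) (by omega))]
  obtain ⟨m, rfl⟩ : ∃ m, n = m + 4 := ⟨n - 4, by omega⟩
  simp only [Nat.card_Icc, Nat.add_sub_cancel, show m + 4 - 1 = m + 3 by omega]
  have c1 : (m + 3).choose 2 = (m + 2).choose 1 + (m + 2).choose 2 := Nat.choose_succ_succ _ _
  have c2 : (m + 2).choose 2 = (m + 1).choose 1 + (m + 1).choose 2 := Nat.choose_succ_succ _ _
  have c3 : (m + 1).choose 2 = m.choose 1 + m.choose 2 := Nat.choose_succ_succ _ _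
  rw [Nat.choose_one_right] at c1 c2 c3
  omega

theorem AlmostStar.isoTo {k n : ℕ} {F : Finset (Finset ℕ)} (hk : 1 ≤ k)
    (hF : F ⊆ powersetCard k (Icc 1 n)) (h : CrossInt F F) (hnc : NoCenter F)
    (hs : AlmostStar F) (hkn : k + 1 ≤ n) (hc : (HMfam n k).card ≤ F.card) : IsoTo n F (HMfam n k) := by
  obtain ⟨x, K, hK, hxK, hcov⟩ := hs
  obtain ⟨hKS, hKc⟩ := mem_powersetCard.1 (hF hK)
  have h1n : 1 ∈ Icc 1 n := mem_Icc.2 ⟨le_rfl, by omega⟩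
  have hxS : x ∈ Icc 1 n := by
    obtain ⟨y, hy⟩ : K.Nonempty := card_pos.1 (by omega)
    obtain ⟨a, ha, hya⟩ := hnc y
    exact (mem_powersetCard.1 (hF ha)).1 (hcov a ha fun h => hya (h ▸ hy))
  set τ := Equiv.swap x 1 with hτ
  have hτS : ∀ y ∈ Icc 1 n, τ y ∈ Icc 1 n := by
    intro y hy
    rw [hτ, Equiv.swap_apply_def]
    split_ifs <;> assumption
  set K' := K.image τ with hK'
  have h1K' : 1 ∉ K' := by
    rw [hK', mem_image]
    rintro ⟨y, hy, hy'⟩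
    have : y = x := τ.injective (by rw [hy', hτ, Equiv.swap_apply_left])
    exact hxK (this ▸ hy)
  obtain ⟨σ, hσ1, hσ2⟩ := exists_perm_mem_iff K' (Icc 2 (k + 1))
    (by rw [hK', card_image_of_injective _ τ.injective, hKc, Nat.card_Icc]; omega)
  have hσS : ∀ y ∈ Icc 1 n, σ y ∈ Icc 1 n := fun y hy =>
    mem_of_forall_fixed (fun z hz => hσ1 z fun hz' => hz (by
      rcases mem_union.1 hz' with hz' | hz'
      · obtain ⟨w, hw, rfl⟩ := mem_image.1 hz'
        exact hτS w (hKS hw)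
      · rw [mem_Icc] at hz' ⊢
        omega)) hy
  have hmaps : ∀ y ∈ Icc 1 n, (τ.trans σ) y ∈ Icc 1 n := fun y hy => hσS _ (hτS y hy)
  have hx1 : (τ.trans σ) x = 1 := by
    rw [Equiv.trans_apply, hτ, Equiv.swap_apply_left]
    exact hσ1 1 (by simp [h1K'])
  have hKiff : ∀ y, (τ.trans σ) y ∈ Icc 2 (k + 1) ↔ y ∈ K := by
    intro y
    rw [Equiv.trans_apply, hσ2, hK']
    exact τ.injective.mem_finset_image
  refine isoTo_of_forall_mem (τ.trans σ) hmaps (fun a ha => ?_) hc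
  by_cases haK : a = K
  · subst haK
    refine mem_insert.2 (Or.inl (eq_of_subset_of_card_le
      (image_subset_iff.2 fun y hy => (hKiff y).2 hy) ?_))
    rw [card_image_of_injective _ (τ.trans σ).injective, hKc, Nat.card_Icc]
    omega
  · refine mem_insert_of_mem (mem_filter.2 ⟨image_mem_powersetCard hmaps (hF ha),
      mem_image.2 ⟨x, hcov a ha haK, hx1⟩, ?_⟩)
    obtain ⟨y, hy, hyK⟩ := h a ha K hK
    exact ⟨_, mem_inter.2 ⟨mem_image_of_mem _ hy, (hKiff y).2 hyK⟩⟩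

theorem TripleLike.isoTo {n : ℕ} {F : Finset (Finset ℕ)} (hF : F ⊆ powersetCard 3 (Icc 1 n))
    (hnc : NoCenter F) (hs : TripleLike F) (hn : 3 ≤ n) (hc : (Tfam n).card ≤ F.card) :
    IsoTo n F (Tfam n) := by
  obtain ⟨x, y, z, hxy, hxz, hyz, h⟩ := hs
  obtain ⟨a, ha, hxa⟩ := hnc x
  obtain ⟨b, hb, hyb⟩ := hnc y
  have hsub : ∀ c ∈ F, c ⊆ Icc 1 n := fun c hc => (mem_powersetCard.1 (hF hc)).1
  have hxS : x ∈ Icc 1 n := hsub b hb (by have := h b hb; tauto)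
  have hyS : y ∈ Icc 1 n := hsub a ha (by have := h a ha; tauto)
  have hzS : z ∈ Icc 1 n := hsub a ha (by have := h a ha; tauto)
  obtain ⟨σ, hσ1, hσ2⟩ := exists_perm_mem_iff {x, y, z} (Icc 1 3)
    (by rw [card_eq_three.2 ⟨x, y, z, hxy, hxz, hyz, rfl⟩, Nat.card_Icc])
  have hσS : ∀ w ∈ Icc 1 n, σ w ∈ Icc 1 n := fun w hw =>
    mem_of_forall_fixed (fun v hv => hσ1 v fun hv' => hv (by
      rcases mem_union.1 hv' with hv' | hv'
      · simp only [mem_insert, mem_singleton] at hv'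
        rcases hv' with rfl | rfl | rfl <;> assumption
      · rw [mem_Icc] at hv' ⊢
        omega)) hw
  refine isoTo_of_forall_mem σ hσS (fun c hc => ?_) hc
  have hpair : ∀ u v, u ≠ v → u ∈ ({x, y, z} : Finset ℕ) → v ∈ ({x, y, z} : Finset ℕ) →
      u ∈ c → v ∈ c → c.image (fun w => σ w) ∈ Tfam n := fun u v huv hu hv huc hvc =>
    mem_Tfam_of_pair (image_mem_powersetCard hσS (hF hc)) (σ.injective.ne huv)
      ((hσ2 u).2 hu) ((hσ2 v).2 hv) (mem_image_of_mem _ huc) (mem_image_of_mem _ hvc)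
  rcases h c hc with ⟨h1, h2⟩ | ⟨h1, h2⟩ | ⟨h1, h2⟩
  · exact hpair x y hxy (by simp) (by simp) h1 h2
  · exact hpair x z hxz (by simp) (by simp) h1 h2
  · exact hpair y z hyz (by simp) (by simp) h1 h2

end

end HiltonMilner

/-- Hilton–Milner theorem. -/
theorem stmt_4 (k n : ℕ) (hk : 2 ≤ k) (hn : 2 * k + 1 ≤ n)
    (F : Finset (Finset ℕ)) (hF : F ⊆ powersetCard k (Icc 1 n))
    (hint : ∀ A ∈ F, ∀ B ∈ F, (A ∩ B).Nonempty)
    (hstar : ¬ ∃ x ∈ Icc 1 n, ∀ A ∈ F, x ∈ A) :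
    ((F.card : ℤ) ≤ ((n - 1).choose (k - 1) : ℤ) - (n - k - 1).choose (k - 1) + 1) ∧
    ((k = 2 ∨ 4 ≤ k) →
      (((F.card : ℤ) = ((n - 1).choose (k - 1) : ℤ) - (n - k - 1).choose (k - 1) + 1) ↔
        IsoTo n F (HMfam n k))) ∧
    (k = 3 →
      (((F.card : ℤ) = ((n - 1).choose (k - 1) : ℤ) - (n - k - 1).choose (k - 1) + 1) ↔
        (IsoTo n F (HMfam n 3) ∨ IsoTo n F (Tfam n)))) := by
  obtain ⟨l, rfl⟩ : ∃ l, k = l + 1 := ⟨k - 1, by omega⟩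
  have h : HiltonMilner.CrossInt F F := fun a ha b hb =>
    (hint a ha b hb).imp fun _ hx => mem_inter.1 hx
  have hne : F.Nonempty := by
    by_contra hcon
    rw [not_nonempty_iff_eq_empty] at hcon
    exact hstar ⟨1, mem_Icc.2 ⟨le_rfl, by omega⟩, by simp [hcon]⟩
  have hnc : HiltonMilner.NoCenter F := by
    intro x
    by_contra hcon
    push Not at hcon
    obtain ⟨a, ha⟩ := hne
    exact hstar ⟨x, (mem_powersetCard.1 (hF ha)).1 (hcon a ha), hcon⟩
  obtain ⟨hle, heq⟩ := HiltonMilner.card_le_of_noCenter n l (Icc 1 n) F (by simp) (by omega) hF h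
    hnc
  have heq := heq hn
  have hHM := HiltonMilner.card_HMfam (l := l) (n := n) (by omega)
  have hT := HiltonMilner.card_Tfam (n := n) (by omega)
  rw [show n - (l + 1) - 1 = n - (l + 2) by omega, Nat.add_sub_cancel]
  have hiso : HiltonMilner.AlmostStar F →
      F.card + (n - (l + 2)).choose l = (n - 1).choose l + 1 → IsoTo n F (HMfam n (l + 1)) :=
    fun hs hc => hs.isoTo (by omega) hF h hnc (by omega) (by omega)
  refine ⟨by omega, fun hl => ⟨fun hc => ?_, fun hi => ?_⟩, fun hl => ?_⟩
  · have hc : F.card + (n - (l + 2)).choose l = (n - 1).choose l + 1 := by omega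
    exact hiso ((heq hc).resolve_right fun h => by omega) hc
  · have := HiltonMilner.card_eq_of_isoTo hi
    omega
  · obtain rfl : l = 2 := by omega
    simp only [Nat.reduceAdd] at hHM heq hiso ⊢
    refine ⟨fun hc => ?_, fun hi => ?_⟩
    · have hc : F.card + (n - 4).choose 2 = (n - 1).choose 2 + 1 := by omega
      rcases heq hc with hs | ⟨-, hs⟩
      · exact Or.inl (hiso hs hc)
      · exact Or.inr (hs.isoTo hF hnc (by omega) (by omega))
    · rcases hi with hi | hi
      · have := HiltonMilner.card_eq_of_isoTo hi
        omega
      · have := HiltonMilner.card_eq_of_isoTo hi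
        omega
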